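/- Let I ⊂ ℝ be an interval and [a,b] a proper subinterval of I. Let 1 ≤ k and 1 ≤ m be integers and let y_1, …, y_m ∈ I \ [a,b]. Assume w_1, …, w_{m+k} : I → ℝ are sufficiently many times differentiable functions such that W(w_1,…,w_{m+n})(y_1,…,y_m, ξ,…,ξ) (with n repeated points ξ appended) is nonzero for all ξ ∈ [a,b] and all n = 0, …, k. Then for all points x_1, …, x_{k+1} ∈ [a,b] that are not all identical and all sufficiently many times differentiable functions f, g : I → ℝ, there exists ξ ∈ ]min_i x_i, max_i x_i[ such that W(w_1,…,w_{m+k},f)(y_1,…,y_m,ξ,…,ξ) · W(w_1,…,w_{m+k},g)(y_1,…,y_m,x_1,…,x_{k+1}) = W(w_1,…,w_{m+k},g)(y_1,…,y_m,ξ,…,ξ) · W(w_1,…,w_{m+k},f)(y_1,…,y_m,x_1,…,x_{k+1}), where in each determinant the block of k+1 points is ξ repeated k+1 times on the left-hand factors and x_1,…,x_{k+1} on the right-hand factors. -/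

import Mathlib

/-- The derivative order attached to column `j`: the number of earlier indices carrying
the same point value as `x j`. -/
noncomputable def multBefore {k : ℕ} (x : Fin k → ℝ) (j : Fin k) : ℕ :=
  Nat.card {i : Fin k // i < j ∧ x i = x j}

/-- Generalized Wronskian determinant of the system `w` at the points `x`
(repetitions of a point produce successive derivative columns). -/
noncomputable def genW {k : ℕ} (w : Fin k → ℝ → ℝ) (x : Fin k → ℝ) : ℝ :=
  Matrix.det (Matrix.of fun i j : Fin k => iteratedDeriv (multBefore x j) (w i) (x j))

/-- Generalized Wronskian determinant with a vector part: the first `m` columns are the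
coordinates of the vectors `u i`, the remaining `k` columns are derivative columns at `x`. -/
noncomputable def genWu (m k : ℕ) (w : Fin (m + k) → ℝ → ℝ) (u : Fin (m + k) → Fin m → ℝ)
    (x : Fin k → ℝ) : ℝ :=
  Matrix.det (Matrix.of fun i j : Fin (m + k) =>
    Fin.addCases (fun jm : Fin m => u i jm)
      (fun jk : Fin k => iteratedDeriv (multBefore x jk) (w i) (x jk)) j)

/-- `f ∈ D^k([a,b])`: `f` is `k-1` times continuously differentiable on `[a,b]` and
`k` times differentiable on `]a,b[`. -/
def MemDk (k : ℕ) (a b : ℝ) (f : ℝ → ℝ) : Prop :=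
  (∀ j < k - 1, ∀ x ∈ Set.Icc a b, DifferentiableAt ℝ (iteratedDeriv j f) x) ∧
  (∀ j ≤ k - 1, ContinuousOn (iteratedDeriv j f) (Set.Icc a b)) ∧
  (∀ x ∈ Set.Ioo a b, DifferentiableAt ℝ (iteratedDeriv (k - 1) f) x)

/-- `f` vanishes `K` times in `[a,b]`. -/
def VanishesTimes (K : ℕ) (a b : ℝ) (f : ℝ → ℝ) : Prop :=
  ∃ (n : ℕ) (x : Fin (n + 1) → ℝ) (κ : Fin (n + 1) → ℕ),
    StrictMono x ∧ (∀ i, x i ∈ Set.Icc a b) ∧ x 0 < b ∧ a < x (Fin.last n) ∧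
    (∀ i, 1 ≤ κ i) ∧ (∑ i, κ i) = K ∧
    ∀ i, ∀ j < κ i, iteratedDeriv j f (x i) = 0

open scoped ContDiff

/-- `φ` and its first `n - 1` derivatives are zero at `ξ`. -/
def VanishesToOrder (n : ℕ) (φ : ℝ → ℝ) (ξ : ℝ) : Prop :=
  ∀ l < n, iteratedDeriv l φ ξ = 0

/-- The linear combination of `s 0, …, s (n - 1)` with coefficients `c`. -/
def linComb (s : ℕ → ℝ → ℝ) (n : ℕ) (c : ℕ → ℝ) : ℝ → ℝ :=
  fun t => ∑ i ∈ Finset.range n, c i * s i t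

lemma VanishesToOrder.congr {n : ℕ} {φ ψ : ℝ → ℝ} {ξ : ℝ} (h : VanishesToOrder n φ ξ)
    (e : φ =ᶠ[nhds ξ] ψ) : VanishesToOrder n ψ ξ :=
  fun l hl => (e.iteratedDeriv l).eq_of_nhds ▸ h l hl

lemma VanishesToOrder.mul {n : ℕ} {φ ψ : ℝ → ℝ} {ξ : ℝ} (h : VanishesToOrder n φ ξ)
    (hφ : ContDiffAt ℝ ∞ φ ξ) (hψ : ContDiffAt ℝ ∞ ψ ξ) :
    VanishesToOrder n (fun t => φ t * ψ t) ξ := by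
  intro l hl
  rw [iteratedDeriv_fun_mul (hφ.of_le (by exact_mod_cast le_top))
    (hψ.of_le (by exact_mod_cast le_top))]
  refine Finset.sum_eq_zero fun i hi => ?_
  rw [h i (by have := Finset.mem_range.1 hi; omega)]
  simp

lemma VanishesToOrder.sub_const_of_deriv {n : ℕ} {φ : ℝ → ℝ} {ξ : ℝ}
    (h : VanishesToOrder n (deriv φ) ξ) :
    VanishesToOrder (n + 1) (fun t => φ t - φ ξ) ξ := by
  intro l hl
  cases l with
  | zero => simp
  | succ l =>
    rw [iteratedDeriv_succ', deriv_sub_const_fun]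
    exact h l (by omega)

lemma contDiffAt_deriv {φ : ℝ → ℝ} {ξ : ℝ} (h : ContDiffAt ℝ ∞ φ ξ) :
    ContDiffAt ℝ ∞ (deriv φ) ξ :=
  h.derivWithin (by simp)

lemma ContDiffAt.eventually_differentiableAt {φ : ℝ → ℝ} {ξ : ℝ} (h : ContDiffAt ℝ ∞ φ ξ) :
    ∀ᶠ t in nhds ξ, DifferentiableAt ℝ φ t := by
  have h1 : ContDiffAt ℝ 1 φ ξ := h.of_le (by exact_mod_cast le_top)
  filter_upwards [h1.eventually (by simp)] with t ht
  exact ht.differentiableAt (by simp)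

lemma linComb_contDiffAt {s : ℕ → ℝ → ℝ} {n : ℕ} {ξ : ℝ}
    (hs : ∀ i < n, ContDiffAt ℝ ∞ (s i) ξ) (c : ℕ → ℝ) :
    ContDiffAt ℝ ∞ (linComb s n c) ξ :=
  ContDiffAt.sum fun i hi => contDiffAt_const.mul (hs i (Finset.mem_range.1 hi))

lemma linComb_succ_add_linComb (v : ℕ → ℝ → ℝ) (n : ℕ) (c d : ℕ → ℝ) :
    (fun t => linComb v (n + 1) c t + linComb v n d t) =
      linComb v (n + 1) (fun i => c i + if i < n then d i else 0) := by
  funext t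
  have : ∑ i ∈ Finset.range n, (if i < n then d i else 0) * v i t =
      ∑ i ∈ Finset.range n, d i * v i t :=
    Finset.sum_congr rfl fun i hi => by rw [if_pos (Finset.mem_range.1 hi)]
  simp only [linComb, Finset.sum_range_succ, lt_irrefl, if_false, add_mul,
    Finset.sum_add_distrib, this]
  ring

/-- Order reduction: dividing by `v 0` and differentiating lowers the order of vanishing by one,
and can be undone up to a multiple of `v 0`. -/
lemma VanishesToOrder.of_deriv_div {v : ℕ → ℝ → ℝ} {h : ℝ → ℝ} {n r : ℕ} {c : ℕ → ℝ} {ξ : ℝ}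
    (hv : ∀ i < n + 1, ContDiffAt ℝ ∞ (v i) ξ) (hh : ContDiffAt ℝ ∞ h ξ) (h0 : v 0 ξ ≠ 0)
    (H : VanishesToOrder r (fun t => deriv (fun s => h s / v 0 s) t +
      linComb (fun i => deriv (fun s => v (i + 1) s / v 0 s)) n c t) ξ) :
    ∃ d : ℕ → ℝ, (∀ i, d (i + 1) = c i) ∧
      VanishesToOrder (r + 1) (fun t => h t + linComb v (n + 1) d t) ξ := by
  have hv0 := hv 0 (by omega)
  have hne : ∀ᶠ t in nhds ξ, v 0 t ≠ 0 := hv0.continuousAt.eventually_ne h0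
  set q : ℝ → ℝ := fun t => h t / v 0 t +
    ∑ i ∈ Finset.range n, c i * (v (i + 1) t / v 0 t) with hq
  have hqs : ContDiffAt ℝ ∞ q ξ :=
    (hh.div hv0 h0).add (ContDiffAt.sum fun i hi =>
      contDiffAt_const.mul ((hv _ (by have := Finset.mem_range.1 hi; omega)).div hv0 h0))
  have hd : ∀ᶠ t in nhds ξ, ∀ i ∈ Finset.range n,
      DifferentiableAt ℝ (fun s => v (i + 1) s / v 0 s) t :=
    (Filter.eventually_all_finset _).2 fun i hi =>
      ((hv _ (by have := Finset.mem_range.1 hi; omega)).div hv0 h0).eventually_differentiableAt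
  have hdq : VanishesToOrder r (deriv q) ξ := by
    refine H.congr ?_
    filter_upwards [hd, (hh.div hv0 h0).eventually_differentiableAt] with t ht ht'
    replace ht' : DifferentiableAt ℝ (fun s => h s / v 0 s) t := ht'
    rw [hq, deriv_fun_add ht' (DifferentiableAt.fun_sum fun i hi => (ht i hi).const_mul _),
      deriv_fun_sum fun i hi => (ht i hi).const_mul _]
    congr 1
    exact Finset.sum_congr rfl fun i hi => (deriv_const_mul _ (ht i hi)).symm
  refine ⟨fun i => if i = 0 then -q ξ else c (i - 1), fun i => by simp, ?_⟩
  refine (hdq.sub_const_of_deriv.mul (hqs.sub contDiffAt_const) hv0).congr ?_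
  filter_upwards [hne] with t ht
  have hqt : q t * v 0 t = h t + ∑ i ∈ Finset.range n, c i * v (i + 1) t := by
    rw [hq, add_mul, div_mul_cancel₀ _ ht, Finset.sum_mul]
    exact congrArg _ (Finset.sum_congr rfl fun i _ => by field_simp)
  simp only [linComb, Finset.sum_range_succ', Nat.succ_ne_zero, if_true, if_false,
    Nat.add_sub_cancel, sub_mul, hqt]
  ring

/-- Rolle's theorem for zeros `x 0 ≤ ⋯ ≤ x (k + 1)` counted with multiplicity. -/
lemma exists_zeros_deriv {k : ℕ} {a b : ℝ} {h : ℝ → ℝ} {x : ℕ → ℝ}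
    (hh : ContinuousOn h (Set.Icc a b))
    (hmono : ∀ i j, i ≤ j → j ≤ k + 1 → x i ≤ x j) (hx : ∀ i ≤ k + 1, x i ∈ Set.Icc a b)
    (hz : ∀ i ≤ k + 1, ∀ j ≤ i, x j = x i → iteratedDeriv (i - j) h (x i) = 0) :
    ∃ z : ℕ → ℝ, (∀ i ≤ k, x i ≤ z i ∧ z i ≤ x (i + 1) ∧
        (x i < x (i + 1) → x i < z i ∧ z i < x (i + 1))) ∧
      ∀ i ≤ k, ∀ j ≤ i, z j = z i → iteratedDeriv (i - j) (deriv h) (z i) = 0 := by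
  have hex : ∀ i, ∃ z, i ≤ k → x i ≤ z ∧ z ≤ x (i + 1) ∧
      (x i < x (i + 1) → x i < z ∧ z < x (i + 1)) ∧ deriv h z = 0 := by
    intro i
    by_cases hi : i ≤ k
    · rcases (hmono i (i + 1) (by omega) (by omega)).eq_or_lt with e | e
      · refine ⟨x i, fun _ => ⟨le_rfl, e.le, fun h' => absurd e h'.ne, ?_⟩⟩
        have := hz (i + 1) (by omega) i (by omega) e
        rw [← e] at this
        simpa using this
      · have h1 := hz i (by omega) i le_rfl rfl
        have h2 := hz (i + 1) (by omega) (i + 1) le_rfl rfl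
        simp only [Nat.sub_self, iteratedDeriv_zero] at h1 h2
        obtain ⟨z, hz1, hz2⟩ := exists_deriv_eq_zero e
          (hh.mono (Set.Icc_subset_Icc (hx i (by omega)).1 (hx (i + 1) (by omega)).2))
          (h1.trans h2.symm)
        exact ⟨z, fun _ => ⟨hz1.1.le, hz1.2.le, fun _ => ⟨hz1.1, hz1.2⟩, hz2⟩⟩
    · exact ⟨0, fun h' => absurd h' hi⟩
  choose z hzz using hex
  refine ⟨z, fun i hi => ⟨(hzz i hi).1, (hzz i hi).2.1, (hzz i hi).2.2.1⟩, ?_⟩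
  intro i hi j hj e
  rcases hj.eq_or_lt with rfl | hlt
  · simpa using (hzz j hi).2.2.2
  · obtain ⟨hi1, hi2, hi3, -⟩ := hzz i hi
    obtain ⟨hj1, hj2, hj3, -⟩ := hzz j (by omega)
    have hm := hmono (j + 1) i (by omega) (by omega)
    have ej : x j = x (j + 1) := by
      by_contra hc
      have := hj3 (lt_of_le_of_ne (hj1.trans hj2) hc)
      linarith
    have ei : x i = x (i + 1) := by
      by_contra hc
      have := hi3 (lt_of_le_of_ne (hi1.trans hi2) hc)
      linarith
    have key := hz (i + 1) (by omega) j (by omega) (by linarith)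
    rw [show i + 1 - j = (i - j) + 1 by omega, iteratedDeriv_succ'] at key
    rwa [show z i = x (i + 1) by linarith]

/-- If every leading subsystem `v 0, …, v (n - 1)` with `n ≤ k` has nonvanishing Wronskian on
`[a, b]` and `h` has `k + 1` zeros there, then the Wronskian of `v 0, …, v (k - 1), h` has a zero
between them; both conditions are phrased via linear combinations. -/
lemma exists_vanishesToOrder_add_linComb {a b : ℝ} (k : ℕ) : ∀ (v : ℕ → ℝ → ℝ) (h : ℝ → ℝ)
    (_ : ∀ i < k, ∀ t ∈ Set.Icc a b, ContDiffAt ℝ ∞ (v i) t)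
    (_ : ∀ t ∈ Set.Icc a b, ContDiffAt ℝ ∞ h t)
    (_ : ∀ n ≤ k, ∀ ξ ∈ Set.Icc a b, ∀ c, VanishesToOrder n (linComb v n c) ξ →
      ∀ i < n, c i = 0)
    (x : ℕ → ℝ) (_ : ∀ i j, i ≤ j → j ≤ k → x i ≤ x j) (_ : ∀ i ≤ k, x i ∈ Set.Icc a b)
    (_ : ∀ i ≤ k, ∀ j ≤ i, x j = x i → iteratedDeriv (i - j) h (x i) = 0),
    ∃ ξ ∈ Set.Icc (x 0) (x k), (x 0 < x k → ξ ∈ Set.Ioo (x 0) (x k)) ∧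
      ∃ d, VanishesToOrder (k + 1) (fun t => h t + linComb v k d t) ξ := by
  induction k with
  | zero =>
    intro v h _ _ _ x _ _ hz
    refine ⟨x 0, ⟨le_rfl, le_rfl⟩, fun hlt => absurd hlt (lt_irrefl _), 0, fun l hl => ?_⟩
    obtain rfl : l = 0 := by omega
    simpa [linComb] using hz 0 le_rfl 0 le_rfl rfl
  | succ k ih =>
    intro v h hv hh hW x hmono hx hz
    have h0 : ∀ t ∈ Set.Icc a b, v 0 t ≠ 0 := by
      intro t ht e
      have := hW 1 (by omega) t ht (fun _ => 1) (fun l hl => by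
        obtain rfl : l = 0 := by omega
        simpa [linComb] using e) 0 (by omega)
      exact one_ne_zero this
    have hdiv : ∀ t ∈ Set.Icc a b, ContDiffAt ℝ ∞ (fun s => h s / v 0 s) t := fun t ht =>
      (hh t ht).div (hv 0 (by omega) t ht) (h0 t ht)
    have hzq : ∀ i ≤ k + 1, ∀ j ≤ i, x j = x i →
        iteratedDeriv (i - j) (fun s => h s / v 0 s) (x i) = 0 := by
      intro i hi j hj e
      have hvan : VanishesToOrder (i - j + 1) h (x i) := by
        intro l hl
        have h1 := hmono j (i - l) (by omega) (by omega)
        have h2 := hmono (i - l) i (by omega) (by omega)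
        have := hz i hi (i - l) (by omega) (by linarith)
        rwa [show i - (i - l) = l by omega] at this
      have := hvan.mul (hh _ (hx i hi)) ((hv 0 (by omega) _ (hx i hi)).inv (h0 _ (hx i hi)))
        (i - j) (by omega)
      simp only [div_eq_mul_inv]
      exact this
    obtain ⟨z, hzx, hz0⟩ := exists_zeros_deriv
      (fun t ht => (hdiv t ht).continuousAt.continuousWithinAt) hmono hx hzq
    have hzmono : ∀ i j, i ≤ j → j ≤ k → z i ≤ z j := by
      intro i j hij hj
      rcases hij.eq_or_lt with rfl | hlt
      · exact le_rfl
      · exact ((hzx i (by omega)).2.1.trans (hmono (i + 1) j (by omega) (by omega))).trans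
          (hzx j hj).1
    obtain ⟨ξ, hξ, hξ', d, hd⟩ := ih (fun i => deriv (fun s => v (i + 1) s / v 0 s))
      (deriv (fun s => h s / v 0 s))
      (fun i hi t ht => contDiffAt_deriv
        ((hv (i + 1) (by omega) t ht).div (hv 0 (by omega) t ht) (h0 t ht)))
      (fun t ht => contDiffAt_deriv (hdiv t ht))
      (by
        intro n hn ξ hξ c hc i hi
        obtain ⟨d, hd, hdv⟩ := VanishesToOrder.of_deriv_div (h := fun _ => 0) (n := n) (r := n)
          (c := c)
          (fun i hi => hv i (by omega) ξ hξ) contDiffAt_const (h0 ξ hξ) (by simpa using hc)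
        rw [← hd]
        exact hW (n + 1) (by omega) ξ hξ d (by simpa using hdv) (i + 1) (by omega))
      z hzmono (fun i hi => ⟨(hx i (by omega)).1.trans (hzx i hi).1,
        (hzx i hi).2.1.trans (hx (i + 1) (by omega)).2⟩) hz0
    have hx0 := (hzx 0 (by omega)).1
    have hxk := (hzx k le_rfl).2.1
    have hξab : ξ ∈ Set.Icc a b :=
      ⟨(hx 0 (by omega)).1.trans (hx0.trans hξ.1), (hξ.2.trans hxk).trans (hx (k + 1) le_rfl).2⟩
    obtain ⟨d', -, hd'⟩ := VanishesToOrder.of_deriv_div (fun i hi => hv i (by omega) ξ hξab)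
      (hh ξ hξab) (h0 ξ hξab) hd
    refine ⟨ξ, ⟨hx0.trans hξ.1, hξ.2.trans hxk⟩, fun hlt => ?_, d', hd'⟩
    rcases (hzmono 0 k (by omega) le_rfl).eq_or_lt with e | e
    · have hzc : ∀ i ≤ k, z i = ξ := fun i hi =>
        le_antisymm ((hzmono i k hi le_rfl).trans (e ▸ hξ.1))
          (hξ.2.trans (e ▸ hzmono 0 i (by omega) hi))
      have : ∃ i ≤ k, x i < x (i + 1) := by
        by_contra! hc
        have : ∀ i ≤ k + 1, x i ≤ x 0 := by
          intro i
          induction i with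
          | zero => intro _; exact le_rfl
          | succ i ihi => intro hi; exact (hc i (by omega)).trans (ihi (by omega))
        exact absurd hlt (this (k + 1) le_rfl).not_gt
      obtain ⟨i, hi, hi'⟩ := this
      have h1 := (hzx i hi).2.2 hi'
      rw [hzc i hi] at h1
      exact ⟨(hmono 0 i (by omega) (by omega)).trans_lt h1.1,
        h1.2.trans_le (hmono (i + 1) (k + 1) (by omega) le_rfl)⟩
    · exact ⟨hx0.trans_lt (hξ' e).1, (hξ' e).2.trans_le hxk⟩

/-- A combination of `v 0, …, v (n - 1)` with `n ≤ k` and `n` zeros in `[a, b]` is trivial. -/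
lemma linComb_coeff_eq_zero {a b : ℝ} {k : ℕ} {v : ℕ → ℝ → ℝ}
    (hv : ∀ i < k, ∀ t ∈ Set.Icc a b, ContDiffAt ℝ ∞ (v i) t)
    (hW : ∀ n ≤ k, ∀ ξ ∈ Set.Icc a b, ∀ c, VanishesToOrder n (linComb v n c) ξ →
      ∀ i < n, c i = 0)
    {x : ℕ → ℝ} (hmono : ∀ i j, i ≤ j → j < k → x i ≤ x j) (hx : ∀ i < k, x i ∈ Set.Icc a b)
    {c : ℕ → ℝ} : ∀ n ≤ k,
    (∀ i < n, ∀ j ≤ i, x j = x i → iteratedDeriv (i - j) (linComb v n c) (x i) = 0) →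
    ∀ i < n, c i = 0 := by
  intro n
  induction n with
  | zero => intro _ _ i hi; omega
  | succ n ih =>
    intro hn hz
    obtain ⟨ξ, hξ, -, d, hd⟩ := exists_vanishesToOrder_add_linComb n v (linComb v (n + 1) c)
      (fun i hi => hv i (by omega))
      (fun t ht => linComb_contDiffAt (fun i hi => hv i (by omega) t ht) c)
      (fun r hr => hW r (by omega)) x (fun i j hij hj => hmono i j hij (by omega))
      (fun i hi => hx i (by omega)) (fun i hi => hz i (by omega))
    have hcn : c n = 0 := by
      have := hW (n + 1) hn ξ ⟨(hx 0 (by omega)).1.trans hξ.1, hξ.2.trans (hx n (by omega)).2⟩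
        _ (linComb_succ_add_linComb v n c d ▸ hd) n (by omega)
      simpa using this
    have e : linComb v (n + 1) c = linComb v n c := by
      funext t
      simp [linComb, Finset.sum_range_succ, hcn]
    rw [e] at hz
    intro i hi
    rcases Nat.lt_succ_iff_lt_or_eq.1 hi with h' | rfl
    · exact ih (by omega) (fun i hi => hz i (by omega)) i h'
    · exact hcn

lemma iteratedDeriv_linComb {s : ℕ → ℝ → ℝ} (hs : ∀ i, ContDiff ℝ ∞ (s i)) (n : ℕ) (c : ℕ → ℝ)
    (l : ℕ) (t : ℝ) :
    iteratedDeriv l (linComb s n c) t = ∑ i ∈ Finset.range n, c i * iteratedDeriv l (s i) t := by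
  induction n with
  | zero =>
    have e : linComb s 0 c = fun _ => 0 := by
      funext t
      simp [linComb]
    simp [e]
  | succ n ih =>
    have e : linComb s (n + 1) c = fun t => linComb s n c t + c n * s n t := by
      funext t
      simp [linComb, Finset.sum_range_succ]
    rw [e, iteratedDeriv_fun_add
      ((linComb_contDiffAt (fun i _ => (hs i).contDiffAt) c).of_le (by exact_mod_cast le_top))
      ((contDiff_const.mul (hs n)).contDiffAt.of_le (by exact_mod_cast le_top)), ih,
      iteratedDeriv_const_mul_field, Finset.sum_range_succ]

lemma genW_eq_zero_iff {s : ℕ → ℝ → ℝ} (hs : ∀ i, ContDiff ℝ ∞ (s i)) {N : ℕ} (p : Fin N → ℝ) :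
    genW (fun i : Fin N => s i) p = 0 ↔ ∃ c : ℕ → ℝ, (∃ i < N, c i ≠ 0) ∧
      ∀ j, iteratedDeriv (multBefore p j) (linComb s N c) (p j) = 0 := by
  rw [genW, ← Matrix.exists_vecMul_eq_zero_iff]
  simp only [iteratedDeriv_linComb hs]
  constructor
  · rintro ⟨c, hc, h⟩
    obtain ⟨i, hi⟩ := Function.ne_iff.1 hc
    refine ⟨fun i => if hi : i < N then c ⟨i, hi⟩ else 0, ⟨i, i.2, by simpa using hi⟩,
      fun j => ?_⟩
    rw [Finset.sum_range]
    simpa [Matrix.vecMul, dotProduct] using congrFun h j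
  · rintro ⟨c, ⟨i, hi, hc⟩, h⟩
    refine ⟨fun i => c i, fun e => hc (congrFun e ⟨i, hi⟩), funext fun j => ?_⟩
    have := h j
    rw [Finset.sum_range] at this
    simpa [Matrix.vecMul, dotProduct] using this

lemma multBefore_eq_sum {N : ℕ} (x : Fin N → ℝ) (j : Fin N) :
    multBefore x j = ∑ i, if i < j ∧ x i = x j then 1 else 0 := by
  rw [multBefore, Nat.card_eq_fintype_card, Fintype.card_subtype, Finset.card_filter]

lemma multBefore_append_left {m n : ℕ} (y : Fin m → ℝ) (p : Fin n → ℝ) (j : Fin m) :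
    multBefore (Fin.append y p) (Fin.castAdd n j) = multBefore y j := by
  simp only [multBefore_eq_sum, Fin.sum_univ_add, Fin.append_left, Fin.append_right]
  have : ∀ i : Fin n, ¬ (Fin.natAdd m i < Fin.castAdd n j) := by
    intro i h
    simp only [Fin.lt_def, Fin.val_natAdd, Fin.val_castAdd] at h
    omega
  have hlt : ∀ i : Fin m, Fin.castAdd n i < Fin.castAdd n j ↔ i < j := fun _ => Iff.rfl
  simp [this, hlt]

lemma multBefore_append_right {m n : ℕ} {y : Fin m → ℝ} {p : Fin n → ℝ}
    (hyp : ∀ i j, y i ≠ p j) (j : Fin n) :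
    multBefore (Fin.append y p) (Fin.natAdd m j) = multBefore p j := by
  simp only [multBefore_eq_sum, Fin.sum_univ_add, Fin.append_left, Fin.append_right]
  simp [hyp]

lemma multBefore_const {n : ℕ} (ξ : ℝ) (j : Fin n) : multBefore (fun _ => ξ) j = j := by
  rw [multBefore_eq_sum]
  simp only [and_true, ← Finset.card_filter]
  rw [show Finset.univ.filter (· < j) = Finset.Iio j by ext; simp, Fin.card_Iio]

lemma exists_multBefore_eq {N : ℕ} (x : Fin N → ℝ) (t : ℝ) {l : ℕ}
    (hl : l < (Finset.univ.filter fun i => x i = t).card) :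
    ∃ j, x j = t ∧ multBefore x j = l := by
  classical
  have hmb : ∀ j, multBefore x j = (Finset.univ.filter fun i => i < j ∧ x i = x j).card := by
    intro j
    rw [multBefore_eq_sum, Finset.card_filter]
  have hsurj := Finset.surjOn_of_injOn_of_card_le
    (s := Finset.univ.filter fun i => x i = t)
    (t := Finset.range (Finset.univ.filter fun i => x i = t).card) (multBefore x)
    (by
      intro j hj
      simp only [Finset.coe_filter, Finset.mem_univ, true_and, Set.mem_ofPred_eq] at hj
      rw [Finset.mem_coe, Finset.mem_range, hmb]
      refine Finset.card_lt_card ((Finset.ssubset_iff_of_subset ?_).2 ⟨j, by simpa using hj, ?_⟩)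
      · intro i hi
        simp only [Finset.mem_filter, Finset.mem_univ, true_and] at hi ⊢
        exact hi.2.trans hj
      · simp)
    (by
      have hlt : ∀ i j, x i = t → x j = t → i < j → multBefore x i < multBefore x j := by
        intro i j hi hj hij
        rw [hmb, hmb]
        refine Finset.card_lt_card ((Finset.ssubset_iff_of_subset ?_).2
          ⟨i, by simp [hij, hi, hj], by simp⟩)
        intro r hr
        simp only [Finset.mem_filter, Finset.mem_univ, true_and] at hr ⊢
        exact ⟨hr.1.trans hij, hr.2.trans (hi.trans hj.symm)⟩
      intro i hi j hj e
      simp only [Finset.coe_filter, Finset.mem_univ, true_and, Set.mem_ofPred_eq] at hi hj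
      rcases lt_trichotomy i j with h | h | h
      · exact absurd e (hlt i j hi hj h).ne
      · exact h
      · exact absurd e (hlt j i hj hi h).ne')
    (by simp)
  obtain ⟨j, hj, e⟩ := hsurj (Finset.mem_coe.2 (Finset.mem_range.2 hl))
  exact ⟨j, by simpa using hj, e⟩

/-- Zeros prescribed by `multBefore x` turn into zeros along the sorted nodes. -/
lemma iteratedDeriv_sort_eq_zero {N : ℕ} {x : Fin N → ℝ} {φ : ℝ → ℝ}
    (h : ∀ j, iteratedDeriv (multBefore x j) φ (x j) = 0) {i j : Fin N} (hji : j ≤ i)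
    (e : x (Tuple.sort x j) = x (Tuple.sort x i)) :
    iteratedDeriv ((i : ℕ) - j) φ (x (Tuple.sort x i)) = 0 := by
  obtain ⟨r, hr, hr'⟩ := exists_multBefore_eq x (x (Tuple.sort x i)) (l := (i : ℕ) - j) (by
    have hsub : (Finset.Icc j i).map (Tuple.sort x).toEmbedding ⊆
        Finset.univ.filter fun r => x r = x (Tuple.sort x i) := by
      intro r hr
      obtain ⟨u, hu, rfl⟩ := Finset.mem_map.1 hr
      rw [Finset.mem_Icc] at hu
      have h1 : x (Tuple.sort x j) ≤ x (Tuple.sort x u) := Tuple.monotone_sort x hu.1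
      have h2 : x (Tuple.sort x u) ≤ x (Tuple.sort x i) := Tuple.monotone_sort x hu.2
      simpa using le_antisymm h2 (e ▸ h1)
    have := Finset.card_le_card hsub
    rw [Finset.card_map, Fin.card_Icc] at this
    have : (j : ℕ) ≤ i := hji
    omega)
  rw [← hr, ← hr']
  exact h r

lemma genW_append_eq_zero_iff {s : ℕ → ℝ → ℝ} (hs : ∀ i, ContDiff ℝ ∞ (s i)) {m n : ℕ}
    {y : Fin m → ℝ} {p : Fin n → ℝ} (hyp : ∀ i j, y i ≠ p j) :
    genW (fun i : Fin (m + n) => s i) (Fin.append y p) = 0 ↔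
      ∃ c : ℕ → ℝ, (∃ i < m + n, c i ≠ 0) ∧
        (∀ j, iteratedDeriv (multBefore y j) (linComb s (m + n) c) (y j) = 0) ∧
        ∀ j, iteratedDeriv (multBefore p j) (linComb s (m + n) c) (p j) = 0 := by
  rw [genW_eq_zero_iff hs]
  refine exists_congr fun c => and_congr_right fun _ => ?_
  simp only [Fin.forall_fin_add, multBefore_append_left, multBefore_append_right hyp,
    Fin.append_left, Fin.append_right]

lemma genW_snoc_sub {N : ℕ} (w : Fin N → ℝ → ℝ) {f g : ℝ → ℝ} (hf : ContDiff ℝ ∞ f)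
    (hg : ContDiff ℝ ∞ g) (α β : ℝ) (p : Fin (N + 1) → ℝ) :
    genW (k := N + 1) (Fin.snoc (α := fun _ => ℝ → ℝ) w (fun t => α * f t - β * g t)) p =
      α * genW (k := N + 1) (Fin.snoc (α := fun _ => ℝ → ℝ) w f) p -
        β * genW (k := N + 1) (Fin.snoc (α := fun _ => ℝ → ℝ) w g) p := by
  have key : ∀ h : ℝ → ℝ, genW (k := N + 1) (Fin.snoc (α := fun _ => ℝ → ℝ) w h) p =
      ((Matrix.of fun i j : Fin (N + 1) => iteratedDeriv (multBefore p j)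
        (Fin.snoc (α := fun _ => ℝ → ℝ) w 0 i) (p j)).updateRow (Fin.last N)
        (fun j => iteratedDeriv (multBefore p j) h (p j))).det := by
    intro h
    rw [genW]
    congr 1
    ext i j
    refine Fin.lastCases ?_ (fun i => ?_) i
    · simp
    · rw [Matrix.updateRow_ne (Fin.castSucc_lt_last i).ne]
      simp
  have hrow : (fun j => iteratedDeriv (multBefore p j) (fun t => α * f t - β * g t) (p j)) =
      α • (fun j => iteratedDeriv (multBefore p j) f (p j)) +
        (-β) • (fun j => iteratedDeriv (multBefore p j) g (p j)) := by
    funext j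
    rw [iteratedDeriv_fun_sub
      ((contDiff_const.mul hf).contDiffAt.of_le (by exact_mod_cast le_top))
      ((contDiff_const.mul hg).contDiffAt.of_le (by exact_mod_cast le_top)),
      iteratedDeriv_const_mul_field, iteratedDeriv_const_mul_field]
    simp
    ring
  rw [key, key, key, hrow, Matrix.det_updateRow_add, Matrix.det_updateRow_smul,
    Matrix.det_updateRow_smul]
  ring

/-- A function can be corrected by a combination of `s 0, …, s (m - 1)` so as to vanish at the
nodes `y`. -/
lemma exists_add_linComb_vanish {s : ℕ → ℝ → ℝ} (hs : ∀ i, ContDiff ℝ ∞ (s i)) {m : ℕ}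
    {y : Fin m → ℝ} (hdet : genW (fun i : Fin m => s i) y ≠ 0) {φ : ℝ → ℝ}
    (hφ : ContDiff ℝ ∞ φ) :
    ∃ D : ℕ → ℝ, ∀ j,
      iteratedDeriv (multBefore y j) (fun t => φ t + linComb s m D t) (y j) = 0 := by
  set A : Matrix (Fin m) (Fin m) ℝ :=
    Matrix.of fun i j : Fin m => iteratedDeriv (multBefore y j) (s i) (y j) with hA
  set r : Fin m → ℝ := fun j => -iteratedDeriv (multBefore y j) φ (y j) with hr
  have hinv : Matrix.vecMul (Matrix.vecMul r A⁻¹) A = r := by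
    rw [Matrix.vecMul_vecMul, Matrix.nonsing_inv_mul A (isUnit_iff_ne_zero.2 hdet),
      Matrix.vecMul_one]
  refine ⟨fun i => if hi : i < m then Matrix.vecMul r A⁻¹ ⟨i, hi⟩ else 0, fun j => ?_⟩
  rw [iteratedDeriv_fun_add (hφ.contDiffAt.of_le (by exact_mod_cast le_top))
    ((linComb_contDiffAt (fun i _ => (hs i).contDiffAt) _).of_le (by exact_mod_cast le_top)),
    iteratedDeriv_linComb hs, Finset.sum_range]
  have := congrFun hinv j
  rw [Matrix.vecMul, dotProduct] at this
  simp only [Fin.is_lt, dif_pos, Fin.eta]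
  change _ + ∑ i, Matrix.vecMul r A⁻¹ i * A i j = 0
  rw [this, hr]
  ring

/-- A combination of the corrected functions `s (m + n) + linComb s m (D n)`, expanded in `s`. -/
lemma linComb_add_linComb_eq (s : ℕ → ℝ → ℝ) (m N : ℕ) (D : ℕ → ℕ → ℝ) (c d : ℕ → ℝ) :
    (fun t => linComb s m c t + linComb (fun n t => s (m + n) t + linComb s m (D n) t) N d t) =
      linComb s (m + N) (fun i => if i < m then c i + ∑ n ∈ Finset.range N, d n * D n i
        else d (i - m)) := by
  funext t
  have h1 : ∑ i ∈ Finset.range m, (if i < m then c i + ∑ n ∈ Finset.range N, d n * D n i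
      else d (i - m)) * s i t =
      ∑ i ∈ Finset.range m, (c i + ∑ n ∈ Finset.range N, d n * D n i) * s i t :=
    Finset.sum_congr rfl fun i hi => by rw [if_pos (Finset.mem_range.1 hi)]
  simp only [linComb, Finset.sum_range_add, h1]
  simp only [add_mul, mul_add, Finset.sum_add_distrib, Finset.sum_mul, Finset.mul_sum]
  rw [Finset.sum_comm]
  simp [mul_assoc]
  ring

/-- Under the nonvanishing hypothesis on the leading Wronskians, vanishing of the full Wronskian
at the nodes `x` forces it to vanish at a single repeated node strictly between them. -/
lemma exists_genW_append_const_eq_zero {k m : ℕ} {a b : ℝ} {y : Fin m → ℝ}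
    (hy : ∀ i, y i ∉ Set.Icc a b) {s : ℕ → ℝ → ℝ} (hs : ∀ i, ContDiff ℝ ∞ (s i))
    (hV : ∀ n ≤ k, ∀ ξ ∈ Set.Icc a b,
      genW (fun i : Fin (m + n) => s i) (Fin.append y (fun _ : Fin n => ξ)) ≠ 0)
    {x : Fin (k + 1) → ℝ} (hx : ∀ i, x i ∈ Set.Icc a b) (hne : ¬ ∀ i j, x i = x j)
    (hzero : genW (fun i : Fin (m + (k + 1)) => s i) (Fin.append y x) = 0) :
    ∃ ξ ∈ Set.Ioo (Finset.univ.inf' Finset.univ_nonempty x)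
        (Finset.univ.sup' Finset.univ_nonempty x),
      genW (fun i : Fin (m + (k + 1)) => s i) (Fin.append y (fun _ : Fin (k + 1) => ξ)) = 0 := by
  have hyp : ∀ {n : ℕ} {p : Fin n → ℝ}, (∀ j, p j ∈ Set.Icc a b) → ∀ i j, y i ≠ p j :=
    fun hp i j e => hy i (e ▸ hp j)
  have hdet : genW (fun i : Fin m => s i) y ≠ 0 := by
    intro h0
    obtain ⟨c, hc, h⟩ := (genW_eq_zero_iff hs y).1 h0
    exact hV 0 (by omega) (x 0) (hx 0)
      ((genW_append_eq_zero_iff hs (fun _ j => j.elim0)).2 ⟨c, hc, h, fun j => j.elim0⟩)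
  choose D hD using fun n => exists_add_linComb_vanish hs hdet (hs (m + n))
  set v : ℕ → ℝ → ℝ := fun n t => s (m + n) t + linComb s m (D n) t with hv
  have hvs : ∀ n, ContDiff ℝ ∞ (v n) := fun n => (hs (m + n)).add
    (contDiff_iff_contDiffAt.2 fun t => linComb_contDiffAt (fun i _ => (hs i).contDiffAt) _)
  have hvy : ∀ N d j, iteratedDeriv (multBefore y j) (linComb v N d) (y j) = 0 := by
    intro N d j
    rw [iteratedDeriv_linComb hvs]
    exact Finset.sum_eq_zero fun n _ => by rw [hD n j, mul_zero]
  have hvexp : ∀ N d, linComb v N d = linComb s (m + N)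
      (fun i => if i < m then 0 + ∑ n ∈ Finset.range N, d n * D n i else d (i - m)) := by
    intro N d
    rw [← linComb_add_linComb_eq s m N D (fun _ => 0) d]
    funext t
    simp [linComb, hv]
  have hgen : ∀ N ξ, ξ ∈ Set.Icc a b → ∀ d, VanishesToOrder N (linComb v N d) ξ →
      (∃ i < N, d i ≠ 0) →
      genW (fun i : Fin (m + N) => s i) (Fin.append y (fun _ : Fin N => ξ)) = 0 := by
    rintro N ξ hξ d hd ⟨i, hi, hdi⟩
    refine (genW_append_eq_zero_iff hs (hyp fun _ => hξ)).2 ⟨fun i => if i < m then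
      0 + ∑ n ∈ Finset.range N, d n * D n i else d (i - m),
      ⟨m + i, by omega, by simpa using hdi⟩, fun j => ?_, fun j => ?_⟩
    · rw [← hvexp N d]
      exact hvy N d j
    · rw [← hvexp N d, multBefore_const]
      exact hd j j.2
  have hW : ∀ n ≤ k, ∀ ξ ∈ Set.Icc a b, ∀ c, VanishesToOrder n (linComb v n c) ξ →
      ∀ i < n, c i = 0 := by
    intro n hn ξ hξ c hc i hi
    by_contra hci
    exact hV n hn ξ hξ (hgen n ξ hξ c hc ⟨i, hi, hci⟩)
  obtain ⟨c, hcne, hcy, hcx⟩ := (genW_append_eq_zero_iff hs (hyp hx)).1 hzero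
  set e : ℕ → ℝ := fun i => c i - ∑ n ∈ Finset.range (k + 1), c (m + n) * D n i with he
  set d : ℕ → ℝ := fun n => c (m + n) with hd
  have hsplit : linComb s (m + (k + 1)) c =
      fun t => linComb s m e t + linComb v (k + 1) d t := by
    rw [hv, linComb_add_linComb_eq]
    funext t
    refine Finset.sum_congr rfl fun i _ => ?_
    by_cases him : i < m
    · simp [him, he, hd]
    · simp [him, hd, Nat.add_sub_cancel' (not_lt.1 him)]
  have hsm : ∀ {q : ℕ → ℝ → ℝ}, (∀ i, ContDiff ℝ ∞ (q i)) → ∀ N c l t,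
      ContDiffAt ℝ (l : ℕ) (linComb q N c) t := fun hq N c l t =>
    (linComb_contDiffAt (fun i _ => (hq i).contDiffAt) c).of_le (by exact_mod_cast le_top)
  have he0 : ∀ i < m, e i = 0 := by
    intro i hi
    by_contra hei
    refine hdet ((genW_eq_zero_iff hs y).2 ⟨e, ⟨i, hi, hei⟩, fun j => ?_⟩)
    have := hcy j
    rwa [hsplit, iteratedDeriv_fun_add (hsm hs _ _ _ _) (hsm hvs _ _ _ _), hvy, add_zero] at this
  have hcv : linComb s (m + (k + 1)) c = linComb v (k + 1) d := by
    rw [hsplit]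
    funext t
    have : linComb s m e t = 0 := Finset.sum_eq_zero fun i hi => by
      rw [he0 i (Finset.mem_range.1 hi), zero_mul]
    rw [this, zero_add]
  have hdne : ∃ n < k + 1, d n ≠ 0 := by
    by_contra! hall
    obtain ⟨i, hi, hci⟩ := hcne
    by_cases him : i < m
    · have h1 := he0 i him
      have h2 : ∑ n ∈ Finset.range (k + 1), d n * D n i = 0 :=
        Finset.sum_eq_zero fun n hn => by rw [hall n (Finset.mem_range.1 hn), zero_mul]
      exact hci (by rw [he] at h1; linarith)
    · exact hci (by simpa [hd, Nat.add_sub_cancel' (not_lt.1 him)] using hall (i - m) (by omega))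
  rw [hcv] at hcx
  set z : ℕ → ℝ := fun i => x (Tuple.sort x ⟨min i k, by omega⟩) with hz
  have hzmono : ∀ i j, i ≤ j → z i ≤ z j := fun i j hij =>
    Tuple.monotone_sort x (Fin.mk_le_mk.2 (min_le_min_right k hij))
  have hzero' : ∀ i ≤ k, ∀ j ≤ i, z j = z i →
      iteratedDeriv (i - j) (linComb v (k + 1) d) (z i) = 0 := by
    intro i hi j hj e
    have := iteratedDeriv_sort_eq_zero hcx
      (Fin.mk_le_mk.2 (min_le_min_right k hj) :
        (⟨min j k, by omega⟩ : Fin (k + 1)) ≤ ⟨min i k, by omega⟩) e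
    simpa only [hz, min_eq_left hi, min_eq_left (hj.trans hi)] using this
  have hzlt : z 0 < z k := by
    refine lt_of_le_of_ne (hzmono 0 k (by omega)) fun e => hne ?_
    have hall : ∀ i, x i = z 0 := by
      intro i
      obtain ⟨u, rfl⟩ := (Tuple.sort x).surjective i
      have hu : x (Tuple.sort x u) = z u := by
        have : min (u : ℕ) k = u := min_eq_left (by omega)
        simp [hz, this]
      rw [hu]
      exact le_antisymm ((hzmono u k (by omega)).trans e.ge) (hzmono 0 u (by omega))
    exact fun i j => (hall i).trans (hall j).symm
  have hdk : d k ≠ 0 := by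
    intro hdk
    have hvk : linComb v (k + 1) d = linComb v k d := by
      funext t
      simp [linComb, Finset.sum_range_succ, hdk]
    rw [hvk] at hzero'
    have := linComb_coeff_eq_zero (fun i _ t _ => (hvs i).contDiffAt) hW
      (fun i j hij _ => hzmono i j hij) (fun i _ => hx _) k le_rfl
      (fun i hi => hzero' i (by omega))
    obtain ⟨n, hn, hdn⟩ := hdne
    rcases Nat.lt_succ_iff_lt_or_eq.1 hn with h | rfl
    · exact hdn (this n h)
    · exact hdn hdk
  obtain ⟨ξ, -, hξ, d', hd'⟩ := exists_vanishesToOrder_add_linComb k v (linComb v (k + 1) d)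
    (fun i _ t _ => (hvs i).contDiffAt)
    (fun t _ => linComb_contDiffAt (fun i _ => (hvs i).contDiffAt) d) hW z
    (fun i j hij _ => hzmono i j hij) (fun i _ => hx _) hzero'
  have hξ := hξ hzlt
  refine ⟨ξ, ⟨(Finset.inf'_le x (Finset.mem_univ _)).trans_lt hξ.1,
    hξ.2.trans_le (Finset.le_sup' x (Finset.mem_univ _))⟩, ?_⟩
  refine hgen (k + 1) ξ ⟨(hx _).1.trans hξ.1.le, hξ.2.le.trans (hx _).2⟩ _
    (linComb_succ_add_linComb v k d d' ▸ hd') ⟨k, by omega, by simpa using hdk⟩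

/-- **A general mean value theorem with nodes outside the interval** (Theorem 2). -/
theorem general_mean_value_theorem_outer_nodes (k m : ℕ) (hk : 1 ≤ k) (hm : 1 ≤ m)
    (I : Set ℝ) (hI : Set.OrdConnected I) (a b : ℝ) (hab : a ≤ b)
    (hsub : Set.Icc a b ⊂ I)
    (y : Fin m → ℝ) (hy : ∀ i, y i ∈ I \ Set.Icc a b)
    (w : Fin (m + k) → ℝ → ℝ) (hw : ∀ i, ContDiff ℝ (⊤ : ℕ∞) (w i))
    (hV : ∀ n, ∀ hn : n ≤ k, ∀ ξ ∈ Set.Icc a b,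
      genW (fun i : Fin (m + n) => w (Fin.castLE (by omega) i))
        (Fin.append y (fun _ : Fin n => ξ)) ≠ 0)
    (x : Fin (k + 1) → ℝ) (hx : ∀ i, x i ∈ Set.Icc a b) (hne : ¬ ∀ i j, x i = x j)
    (f g : ℝ → ℝ) (hf : ContDiff ℝ (⊤ : ℕ∞) f) (hg : ContDiff ℝ (⊤ : ℕ∞) g) :
    ∃ ξ ∈ Set.Ioo (Finset.univ.inf' Finset.univ_nonempty x)
        (Finset.univ.sup' Finset.univ_nonempty x),
      genW (k := m + (k + 1)) (Fin.snoc w f) (Fin.append y (fun _ : Fin (k + 1) => ξ)) *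
          genW (k := m + (k + 1)) (Fin.snoc w g) (Fin.append y x) =
        genW (k := m + (k + 1)) (Fin.snoc w g) (Fin.append y (fun _ : Fin (k + 1) => ξ)) *
          genW (k := m + (k + 1)) (Fin.snoc w f) (Fin.append y x) := by
  set F : ℝ → ℝ := fun t => genW (k := m + (k + 1)) (Fin.snoc w g) (Fin.append y x) * f t -
    genW (k := m + (k + 1)) (Fin.snoc w f) (Fin.append y x) * g t with hF
  set s : ℕ → ℝ → ℝ := fun i => if hi : i < m + k then w ⟨i, hi⟩ else F with hs
  have hFs : ContDiff ℝ ∞ F := (contDiff_const.mul hf).sub (contDiff_const.mul hg)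
  have hss : ∀ i, ContDiff ℝ ∞ (s i) := by
    intro i
    by_cases hi : i < m + k
    · simpa [hs, hi] using hw ⟨i, hi⟩
    · simpa [hs, hi] using hFs
  have hsnoc : (fun i : Fin (m + (k + 1)) => s i) =
      (Fin.snoc (α := fun _ => ℝ → ℝ) w F : Fin (m + k + 1) → ℝ → ℝ) := by
    funext i
    refine Fin.lastCases (n := m + k) ?_ (fun i => ?_) i
    · rw [Fin.snoc_last]
      simp [hs]
    · rw [Fin.snoc_castSucc]
      simp [hs]
  obtain ⟨ξ, hξ, h⟩ := exists_genW_append_const_eq_zero (fun i => (hy i).2) hss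
    (fun n hn ξ hξ => by
      convert hV n hn ξ hξ using 2
      funext i
      have : (i : ℕ) < m + k := by omega
      simp [hs, this, Fin.castLE]) hx hne
    (by
      rw [hsnoc]
      refine (genW_snoc_sub w hf hg _ _ _).trans ?_
      ring)
  refine ⟨ξ, hξ, ?_⟩
  rw [hsnoc] at h
  have := (genW_snoc_sub w hf hg _ _ _).symm.trans h
  linarith
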